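/- A \emph{PO system} is a set $P$ with a transitive antisymmetric relation $<$ (which need be neither reflexive nor irreflexive). A \emph{morphism} of PO systems $\alpha\colon Q\to P$ is a map such that for each $q\in Q$ the image under $\alpha$ of $\{r\in Q\mid r>q\}$ equals $\{p\in P\mid p>\alpha(q)\}$. A PO system is \emph{simple} if every morphism from it to a PO system is injective. An $\omega$-\emph{Stone space} is a second countable, locally compact, Hausdorff, totally disconnected space $W$; let $R=\mathrm{Co}(W)$ be the Boolean ring (possibly without $1$) of compact open subsets of $W$, and for $A\in R$ let $(A)=\{C\in R\mid C\subseteq A\}$. An element $A\in R$ is \emph{pseudo-indecomposable} (PI) if $A\neq\emptyset$ and for every $B\in R$ with $B\subseteq A$ either $(B)\cong(A)$ or $(A\setminus B)\cong(A)$. The space $W$ is \emph{primitive} if every element of $R$ is a disjoint union of finitely many PI elements (the empty set being the empty union). The \emph{structure diagram} $\mathscr{S}(W)$ is the PO system whose elements are the isomorphism classes $[A]$ of the ideals $(A)$ for PI elements $A\in R$, with $[A]<[B]$ if and only if $(A)\times(B)\cong(A)$. Let $W$ be a primitive $\omega$-Stone space. Then its structure diagram $\mathscr{S}(W)$ is a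 simple PO system, i.e. every morphism from $\mathscr{S}(W)$ to a PO system is injective. -/

import Mathlib

open TopologicalSpace

universe u v

/-- A PO system structure on `P`: a transitive antisymmetric relation `<`
(not required to be reflexive or irreflexive). -/
structure POSystem (P : Type u) : Type u where
  lt : P → P → Prop
  lt_trans : ∀ {a b c}, lt a b → lt b c → lt a c
  lt_antisymm : ∀ {a b}, lt a b → lt b a → a = b

namespace POSystem

/-- `α : Q → P` is a morphism if the image of `{r | r > q}` is `{p | p > α q}` for each `q`. -/
def IsMorphism {Q : Type u} {P : Type v} (SQ : POSystem Q) (SP : POSystem P) (α : Q → P) : Prop :=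
  ∀ q : Q, α '' {r | SQ.lt q r} = {p | SP.lt (α q) p}

/-- A PO system is simple if every morphism from it to a PO system (in the universe `v`)
is injective. -/
def IsSimple {Q : Type u} (SQ : POSystem Q) : Prop :=
  ∀ (P : Type v) (SP : POSystem P) (α : Q → P), IsMorphism SQ SP α → Function.Injective α

end POSystem

section BooleanRing

/-! A Boolean ring, possibly without `1`, is the same thing as a generalized Boolean algebra.
The ideal `(A)` is `Set.Iic A`. It is a Boolean algebra, and an isomorphism of Boolean
algebras is the same thing as an order isomorphism. -/

variable {R : Type u} [GeneralizedBooleanAlgebra R]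

/-- `(A) ≅ (B)`. -/
def IdealIso (A B : R) : Prop := Nonempty (Set.Iic A ≃o Set.Iic B)

/-- `(A) × (B) ≅ (A)`. -/
def IdealAbsorbs (A B : R) : Prop := Nonempty (Set.Iic A × Set.Iic B ≃o Set.Iic A)

/-- `A` is pseudo-indecomposable: it is nonzero and, for each `B ≤ A`, either `(B) ≅ (A)` or
`(A - B) ≅ (A)`. -/
def IsPI (A : R) : Prop :=
  A ≠ ⊥ ∧ ∀ B : R, B ≤ A → IdealIso B A ∨ IdealIso (A \ B) A

/-- `R` is primitive: every element is a disjoint union of finitely many PI elements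
(the zero element being the empty union). -/
def IsPrimitiveRing (R : Type u) [GeneralizedBooleanAlgebra R] : Prop :=
  ∀ A : R, ∃ (n : ℕ) (F : Fin n → R), (∀ i, IsPI (F i)) ∧
    (Pairwise fun i j => Disjoint (F i) (F j)) ∧ A = Finset.univ.sup F

/-- The product of two order isomorphisms. -/
def orderIsoProd {α β γ δ : Type*} [Preorder α] [Preorder β] [Preorder γ] [Preorder δ]
    (e : α ≃o β) (f : γ ≃o δ) : α × γ ≃o β × δ where
  toEquiv := e.toEquiv.prodCongr f.toEquiv
  map_rel_iff' {a b} := by simp [Prod.le_def]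

theorem IdealAbsorbs.congr {A A' B B' : R} (hA : IdealIso A A') (hB : IdealIso B B')
    (h : IdealAbsorbs A B) : IdealAbsorbs A' B' := by
  obtain ⟨e⟩ := hA
  obtain ⟨f⟩ := hB
  obtain ⟨g⟩ := h
  exact ⟨(orderIsoProd e.symm f.symm).trans (g.trans e)⟩

theorem IdealAbsorbs.trans {A B C : R} (h₁ : IdealAbsorbs A B) (h₂ : IdealAbsorbs B C) : IdealAbsorbs A C := by
  obtain ⟨e⟩ := h₁
  obtain ⟨f⟩ := h₂
  exact ⟨(orderIsoProd e.symm (OrderIso.refl _)).trans <|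
    (OrderIso.prodAssoc _ _ _).trans <| (orderIsoProd (OrderIso.refl _) f).trans e⟩

theorem IdealAbsorbs.antisymm {A B : R} (h₁ : IdealAbsorbs A B) (h₂ : IdealAbsorbs B A) : IdealIso A B := by
  obtain ⟨e⟩ := h₁
  obtain ⟨f⟩ := h₂
  exact ⟨e.symm.trans (OrderIso.prodComm.trans f)⟩

/-- The PI elements of `R` up to isomorphism of the ideals that they generate. -/
def piIsoSetoid (R : Type u) [GeneralizedBooleanAlgebra R] : Setoid {A : R // IsPI A} where
  r A B := IdealIso A.1 B.1
  iseqv := ⟨fun _ => ⟨OrderIso.refl _⟩, fun ⟨e⟩ => ⟨e.symm⟩, fun ⟨e⟩ ⟨f⟩ => ⟨e.trans f⟩⟩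

/-- The set of isomorphism classes `[A]` of the ideals `(A)`, for `A` a PI element of `R`. -/
def PIClass (R : Type u) [GeneralizedBooleanAlgebra R] : Type u := Quotient (piIsoSetoid R)

/-- The PO system of isomorphism classes `[A]` of PI elements, with `[A] < [B]` iff
`(A) × (B) ≅ (A)`. -/
def piSystem (R : Type u) [GeneralizedBooleanAlgebra R] : POSystem (PIClass R) where
  lt := Quotient.lift₂ (fun A B => IdealAbsorbs A.1 B.1) fun _ _ _ _ hA hB =>
    propext ⟨IdealAbsorbs.congr hA hB,
      IdealAbsorbs.congr ((piIsoSetoid R).symm hA) ((piIsoSetoid R).symm hB)⟩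
  lt_trans {a b c} := by
    induction a, b using Quotient.inductionOn₂
    induction c using Quotient.inductionOn
    exact IdealAbsorbs.trans
  lt_antisymm {a b} := by
    induction a, b using Quotient.inductionOn₂
    exact fun h₁ h₂ => Quotient.sound (IdealAbsorbs.antisymm h₁ h₂)

end BooleanRing

section Space

variable (W : Type u) [TopologicalSpace W]

/-- An ω-Stone space: second countable, locally compact, Hausdorff, totally disconnected. -/
class OmegaStoneSpace : Prop extends SecondCountableTopology W, LocallyCompactSpace W,
  T2Space W, TotallyDisconnectedSpace W

/-- `W` is primitive if its Boolean ring `Co(W)` of compact open subsets is. -/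
def IsPrimitiveSpace [T2Space W] : Prop := IsPrimitiveRing (CompactOpens W)

/-- The structure diagram `𝒮(W)`. -/
def structureDiagram [T2Space W] : POSystem (PIClass (CompactOpens W)) :=
  piSystem (CompactOpens W)

end Space

section IdealIso

variable {R : Type u} [GeneralizedBooleanAlgebra R]

theorem IdealIso.refl (A : R) : IdealIso A A := ⟨OrderIso.refl _⟩

theorem IdealIso.symm {A B : R} (h : IdealIso A B) : IdealIso B A := h.map OrderIso.symm

theorem IdealIso.trans {A B C : R} (h : IdealIso A B) (h' : IdealIso B C) : IdealIso A C :=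
  let ⟨e⟩ := h
  let ⟨f⟩ := h'
  ⟨e.trans f⟩

/-- A correspondence between the elements of `(A)` and those of `(B)` that is total on both sides
and compatible with the orders comes from an isomorphism. -/
theorem IdealIso.of_rel {A B : R} (E : R → R → Prop) (hl : ∀ c ≤ A, ∃ d ≤ B, E c d)
    (hr : ∀ d ≤ B, ∃ c ≤ A, E c d)
    (hE : ∀ c d c' d', E c d → E c' d' → (c ≤ c' ↔ d ≤ d')) : IdealIso A B := by
  choose! f hf hEf using hl
  choose! g hg hEg using hr
  refine ⟨⟨⟨fun c => ⟨f c, hf _ c.2⟩, fun d => ⟨g d, hg _ d.2⟩, fun c => ?_, fun d => ?_⟩, ?_⟩⟩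
  · have h₁ := hEf _ c.2
    have h₂ := hEg _ (hf _ c.2)
    exact Subtype.ext (le_antisymm ((hE _ _ _ _ h₂ h₁).2 le_rfl) ((hE _ _ _ _ h₁ h₂).2 le_rfl))
  · have h₁ := hEg _ d.2
    have h₂ := hEf _ (hg _ d.2)
    exact Subtype.ext (le_antisymm ((hE _ _ _ _ h₂ h₁).1 le_rfl) ((hE _ _ _ _ h₁ h₂).1 le_rfl))
  · intro c c'
    exact (hE _ _ _ _ (hEf _ c.2) (hEf _ c'.2)).symm

/-- For disjoint `A` and `B`, the ideal `(A ⊔ B)` is the product of `(A)` and `(B)`. -/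
def iicSupOrderIso {A B : R} (h : Disjoint A B) : Set.Iic (A ⊔ B) ≃o Set.Iic A × Set.Iic B where
  toFun c := (⟨c ⊓ A, inf_le_right⟩, ⟨c ⊓ B, inf_le_right⟩)
  invFun p := ⟨p.1 ⊔ p.2, sup_le_sup p.1.2 p.2.2⟩
  left_inv c := Subtype.ext (by
    change c.1 ⊓ A ⊔ c.1 ⊓ B = c.1
    rw [← inf_sup_left]
    exact inf_eq_left.2 c.2)
  right_inv := by
    rintro ⟨⟨a, ha⟩, ⟨b, hb⟩⟩
    have h₁ : b ⊓ A = ⊥ := (h.symm.mono_left hb).eq_bot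
    have h₂ : a ⊓ B = ⊥ := (h.mono_left ha).eq_bot
    refine Prod.ext (Subtype.ext ?_) (Subtype.ext ?_)
    · simpa [inf_sup_right, h₁] using ha
    · simpa [inf_sup_right, h₂] using hb
  map_rel_iff' {c d} := by
    change (c.1 ⊓ A ≤ d.1 ⊓ A ∧ c.1 ⊓ B ≤ d.1 ⊓ B) ↔ c.1 ≤ d.1
    refine ⟨fun ⟨h₁, h₂⟩ => ?_, fun h => ⟨inf_le_inf_right _ h, inf_le_inf_right _ h⟩⟩
    calc c.1 = c.1 ⊓ (A ⊔ B) := (inf_eq_left.2 c.2).symm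
      _ = c.1 ⊓ A ⊔ c.1 ⊓ B := inf_sup_left ..
      _ ≤ d.1 := sup_le (h₁.trans inf_le_left) (h₂.trans inf_le_left)

theorem IdealIso.sup {A A' B B' : R} (hA : IdealIso A A') (hB : IdealIso B B')
    (h : Disjoint A B) (h' : Disjoint A' B') : IdealIso (A ⊔ B) (A' ⊔ B') := by
  obtain ⟨e⟩ := hA
  obtain ⟨f⟩ := hB
  exact ⟨(iicSupOrderIso h).trans ((orderIsoProd e f).trans (iicSupOrderIso h').symm)⟩

theorem IdealIso.eq_bot {A B : R} (h : IdealIso A B) (hA : A = ⊥) : B = ⊥ := by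
  obtain ⟨e⟩ := h
  subst hA
  have h₁ : e.symm ⟨B, le_rfl⟩ = e.symm ⟨⊥, bot_le⟩ :=
    Subtype.ext ((le_bot_iff.1 (e.symm _).2).trans (le_bot_iff.1 (e.symm _).2).symm)
  exact congrArg Subtype.val (e.symm.injective h₁)

theorem sdiff_eq_of_disjoint_of_sup_eq {A B C : R} (h : Disjoint A B) (hs : A ⊔ B = C) :
    C \ B = A := by
  rw [← hs, h.sup_sdiff_cancel_right]

/-- Under an isomorphism `(A) ≅ (B)`, a splitting of `A` is carried to a splitting of `B`. -/
theorem IdealIso.exists_split {A B C : R} (h : IdealIso A B) (hC : C ≤ A) :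
    ∃ D ≤ B, IdealIso C D ∧ IdealIso (A \ C) (B \ D) := by
  obtain ⟨e⟩ := h
  have key : ∀ c : Set.Iic A, IdealIso c.1 (e c).1 := fun c => by
    refine IdealIso.of_rel (fun x y => ∃ h : x ≤ A, (e ⟨x, h⟩).1 = y) ?_ ?_ ?_
    · intro x hx
      have : e ⟨x, hx.trans c.2⟩ ≤ e c := e.monotone hx
      exact ⟨_, this, _, rfl⟩
    · intro y hy
      refine ⟨e.symm ⟨y, hy.trans (e c).2⟩, ?_, (e.symm _).2, by simp⟩
      have : e.symm ⟨y, hy.trans (e c).2⟩ ≤ c := e.symm_apply_le.2 hy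
      exact this
    · rintro x _ x' _ ⟨h, rfl⟩ ⟨h', rfl⟩
      exact (e.le_iff_le (x := ⟨x, h⟩) (y := ⟨x', h'⟩)).symm
  have hd : Disjoint (e ⟨A \ C, sdiff_le⟩) (e ⟨C, hC⟩) := by
    rw [disjoint_map_orderIso_iff]
    intro z h₁ h₂
    exact disjoint_sdiff_self_left (x := C) (y := A) h₁ h₂
  have hs : (e ⟨A \ C, sdiff_le⟩).1 ⊔ (e ⟨C, hC⟩).1 = B := by
    have h₁ : e ⟨A \ C, sdiff_le⟩ ⊔ e ⟨C, hC⟩ = e ⟨A, le_rfl⟩ := by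
      rw [← e.map_sup]
      exact congrArg e (Subtype.ext (sdiff_sup_cancel hC))
    have h₂ : e ⟨A, le_rfl⟩ = ⟨B, le_rfl⟩ :=
      le_antisymm (e _).2 (e.symm_apply_le.1 (e.symm _).2)
    exact congrArg Subtype.val (h₁.trans h₂)
  have hd' : Disjoint (e ⟨A \ C, sdiff_le⟩).1 (e ⟨C, hC⟩).1 := fun z h₁ h₂ =>
    hd (show (⟨z, h₂.trans (e _).2⟩ : Set.Iic B) ≤ _ from h₁) h₂
  refine ⟨_, (e ⟨C, hC⟩).2, key ⟨C, hC⟩, ?_⟩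
  rw [sdiff_eq_of_disjoint_of_sup_eq hd' hs]
  exact key ⟨A \ C, sdiff_le⟩

theorem idealAbsorbs_of_le {A G : R} (hG : G ≤ A) (h : IdealIso (A \ G) A) : IdealAbsorbs A G := by
  obtain ⟨e⟩ := h
  have f := iicSupOrderIso (disjoint_sdiff_self_left (x := G) (y := A))
  rw [sdiff_sup_cancel hG] at f
  exact ⟨(orderIsoProd e.symm (OrderIso.refl _)).trans f.symm⟩

/-- If `(A) × (B) ≅ (A)`, then a copy of `B` can be removed from `A` without changing `(A)`. -/
theorem IdealAbsorbs.exists_le {A B : R} (h : IdealAbsorbs A B) :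
    ∃ G ≤ A, IdealIso B G ∧ IdealIso A (A \ G) := by
  obtain ⟨e⟩ := h
  let i : Set.Iic B → R := fun b => e (⟨⊥, bot_le⟩, b)
  let j : Set.Iic A → R := fun a => e (a, ⟨⊥, bot_le⟩)
  have hd : Disjoint (j ⟨A, le_rfl⟩) (i ⟨B, le_rfl⟩) := fun z h₁ h₂ => by
    have hz : z ≤ A := h₁.trans (e _).2
    have h₁' : e.symm ⟨z, hz⟩ ≤ (⟨A, le_rfl⟩, ⟨⊥, bot_le⟩) := e.symm_apply_le.2 h₁
    have h₂' : e.symm ⟨z, hz⟩ ≤ (⟨⊥, bot_le⟩, ⟨B, le_rfl⟩) := e.symm_apply_le.2 h₂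
    have h₃ : e.symm ⟨z, hz⟩ ≤ e.symm ⟨⊥, bot_le⟩ :=
      ⟨h₂'.1.trans (bot_le (α := R)), h₁'.2.trans (bot_le (α := R))⟩
    exact e.symm.le_iff_le.1 h₃
  have hs : j ⟨A, le_rfl⟩ ⊔ i ⟨B, le_rfl⟩ = A := by
    refine le_antisymm (sup_le (e _).2 (e _).2) ?_
    have h₁ : e.symm ⟨A, le_rfl⟩ ≤ (⟨A, le_rfl⟩, ⟨⊥, bot_le⟩) ⊔ (⟨⊥, bot_le⟩, ⟨B, le_rfl⟩) :=
      ⟨(e.symm _).1.2.trans le_sup_left, (e.symm _).2.2.trans le_sup_right⟩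
    rw [e.symm_apply_le, e.map_sup] at h₁
    exact h₁
  refine ⟨i ⟨B, le_rfl⟩, (e _).2, ?_, ?_⟩
  · refine IdealIso.of_rel (fun x y => ∃ h : x ≤ B, i ⟨x, h⟩ = y) ?_ ?_ ?_
    · exact fun x hx => ⟨i ⟨x, hx⟩, e.monotone ⟨le_rfl, hx⟩, hx, rfl⟩
    · intro y hy
      have h₁ : e.symm ⟨y, hy.trans (e _).2⟩ ≤ (⟨⊥, bot_le⟩, ⟨B, le_rfl⟩) := e.symm_apply_le.2 hy
      refine ⟨_, h₁.2, h₁.2, ?_⟩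
      have h₂ : ((⟨⊥, bot_le⟩, ⟨_, h₁.2⟩) : Set.Iic A × Set.Iic B) =
          e.symm ⟨y, hy.trans (e _).2⟩ :=
        Prod.ext (Subtype.ext (le_bot_iff.1 (show (_ : R) ≤ ⊥ from h₁.1)).symm) rfl
      change (e _).1 = y
      rw [h₂, e.apply_symm_apply]
    · rintro x _ x' _ ⟨h, rfl⟩ ⟨h', rfl⟩
      change _ ↔ e _ ≤ e _
      rw [e.le_iff_le]
      exact ⟨fun h => ⟨le_rfl, h⟩, fun h => h.2⟩
  · rw [sdiff_eq_of_disjoint_of_sup_eq hd hs]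
    refine IdealIso.of_rel (fun x y => ∃ h : x ≤ A, j ⟨x, h⟩ = y) ?_ ?_ ?_
    · exact fun x hx => ⟨j ⟨x, hx⟩, e.monotone ⟨hx, le_rfl⟩, hx, rfl⟩
    · intro y hy
      have h₁ : e.symm ⟨y, hy.trans (e _).2⟩ ≤ (⟨A, le_rfl⟩, ⟨⊥, bot_le⟩) := e.symm_apply_le.2 hy
      refine ⟨_, h₁.1, h₁.1, ?_⟩
      have h₂ : ((⟨_, h₁.1⟩, ⟨⊥, bot_le⟩) : Set.Iic A × Set.Iic B) =
          e.symm ⟨y, hy.trans (e _).2⟩ :=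
        Prod.ext rfl (Subtype.ext (le_bot_iff.1 (show (_ : R) ≤ ⊥ from h₁.2)).symm)
      change (e _).1 = y
      rw [h₂, e.apply_symm_apply]
    · rintro x _ x' _ ⟨h, rfl⟩ ⟨h', rfl⟩
      change _ ↔ e _ ≤ e _
      rw [e.le_iff_le]
      exact ⟨fun h => ⟨h, le_rfl⟩, fun h => h.1⟩

end IdealIso

section BackAndForth

variable {R : Type u} [GeneralizedBooleanAlgebra R]

/-- A binary tree of elements in which every node is the disjoint union of its two children. -/
structure IsSplittingTree (f : List Bool → R) : Prop where
  sup_eq : ∀ l, f (true :: l) ⊔ f (false :: l) = f l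
  disjoint : ∀ l, Disjoint (f (true :: l)) (f (false :: l))

theorem IsSplittingTree.cons_le {f : List Bool → R} (hf : IsSplittingTree f) (b : Bool)
    (l : List Bool) : f (b :: l) ≤ f l := by
  rw [← hf.sup_eq l]
  cases b
  exacts [le_sup_right, le_sup_left]

theorem IsSplittingTree.inf_root_le {f : List Bool → R} (hf : IsSplittingTree f) {z w : R} (n : ℕ)
    (h : ∀ l, l.length = n → z ⊓ f l ≤ w) : z ⊓ f [] ≤ w := by
  induction n with
  | zero => exact h [] rfl
  | succ n ih =>
    refine ih fun l hl => ?_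
    rw [← hf.sup_eq l, inf_sup_left]
    exact sup_le (h _ (by simp [hl])) (h _ (by simp [hl]))

/-- Elements below the nodes of a fixed level can be glued to an element below the root. -/
theorem IsSplittingTree.exists_glue {f : List Bool → R} (hf : IsSplittingTree f) (n : ℕ)
    (d : List Bool → R) (hd : ∀ l, l.length = n → d l ≤ f l) :
    ∃ D ≤ f [], ∀ l, l.length = n → D ⊓ f l = d l := by
  induction n generalizing d with
  | zero =>
    refine ⟨d [], hd _ rfl, fun l hl => ?_⟩
    rw [List.length_eq_zero_iff.1 hl]
    exact inf_eq_left.2 (hd _ rfl)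
  | succ n ih =>
    have hd' : ∀ b l, l.length = n → d (b :: l) ≤ f (b :: l) := fun b l hl => hd _ (by simp [hl])
    obtain ⟨D, hD, h⟩ := ih (fun l => d (true :: l) ⊔ d (false :: l)) fun l hl => by
      rw [← hf.sup_eq l]
      exact sup_le_sup (hd' _ _ hl) (hd' _ _ hl)
    refine ⟨D, hD, fun l hl => ?_⟩
    obtain _ | ⟨b, l⟩ := l
    · simp at hl
    replace hl : l.length = n := by simpa using hl
    rw [← inf_eq_right.2 (hf.cons_le b l), ← inf_assoc, h l hl, inf_sup_right]
    cases b
    · rw [((hf.disjoint l).mono_left (hd' _ _ hl)).eq_bot, bot_sup_eq,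
        inf_eq_left.2 (hd' _ _ hl)]
    · rw [((hf.disjoint l).symm.mono_left (hd' _ _ hl)).eq_bot, sup_bot_eq,
        inf_eq_left.2 (hd' _ _ hl)]

/-- `C` and `D` contain the same nodes of level `n` and are disjoint from the others. -/
def MatchedAt (f g : List Bool → R) (n : ℕ) (C D : R) : Prop :=
  ∀ l, l.length = n → (f l ≤ C ∧ g l ≤ D) ∨ (Disjoint (f l) C ∧ Disjoint (g l) D)

theorem MatchedAt.symm {f g : List Bool → R} {n : ℕ} {C D : R} (h : MatchedAt f g n C D) :
    MatchedAt g f n D C :=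
  fun l hl => (h l hl).imp And.symm And.symm

theorem MatchedAt.mono {f g : List Bool → R} (hf : IsSplittingTree f) (hg : IsSplittingTree g)
    {n m : ℕ} {C D : R} (h : MatchedAt f g n C D) (hnm : n ≤ m) : MatchedAt f g m C D := by
  induction m, hnm using Nat.le_induction with
  | base => exact h
  | succ m _ ih =>
    intro l hl
    obtain _ | ⟨b, l⟩ := l
    · simp at hl
    replace hl : l.length = m := by simpa using hl
    exact (ih l hl).imp
      (And.imp (hf.cons_le b l).trans (hg.cons_le b l).trans)
      (And.imp (Disjoint.mono_left (hf.cons_le b l)) (Disjoint.mono_left (hg.cons_le b l)))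

theorem MatchedAt.le_of_le {f g : List Bool → R} (hg : IsSplittingTree g)
    (hfg : ∀ l, f l = ⊥ → g l = ⊥) {n : ℕ} {C D C' D' : R} (h : MatchedAt f g n C D)
    (h' : MatchedAt f g n C' D') (hD : D ≤ g []) (hC : C ≤ C') : D ≤ D' := by
  rw [← inf_eq_left.2 hD]
  refine hg.inf_root_le n fun l hl => ?_
  rcases h l hl with ⟨h₁, h₂⟩ | ⟨h₁, h₂⟩
  · rcases h' l hl with ⟨h₃, h₄⟩ | ⟨h₃, h₄⟩
    · exact inf_le_right.trans h₄
    · have : f l = ⊥ := disjoint_self.1 (h₃.mono_right (h₁.trans hC))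
      simp [hfg l this]
  · simp [h₂.symm.eq_bot]

theorem IsSplittingTree.exists_matchedAt {f g : List Bool → R} (hg : IsSplittingTree g) {C : R}
    {n : ℕ} (h : ∀ l, l.length = n → f (true :: l) ≤ C ∧ Disjoint (f (false :: l)) C) :
    ∃ D ≤ g [], MatchedAt f g (n + 1) C D := by
  obtain ⟨D, hD, hDn⟩ := hg.exists_glue n (fun l => g (true :: l)) fun l _ => hg.cons_le _ _
  refine ⟨D, hD, fun l hl => ?_⟩
  obtain _ | ⟨b, l⟩ := l
  · simp at hl
  replace hl : l.length = n := by simpa using hl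
  cases b
  · refine Or.inr ⟨(h l hl).2, ?_⟩
    rw [disjoint_iff_inf_le]
    calc g (false :: l) ⊓ D ≤ g (false :: l) ⊓ (D ⊓ g l) :=
          le_inf inf_le_left (le_inf inf_le_right (inf_le_left.trans (hg.cons_le _ _)))
      _ ≤ ⊥ := by
          rw [hDn l hl]
          exact (hg.disjoint l).symm.le_bot
  · refine Or.inl ⟨(h l hl).1, ?_⟩
    rw [← hDn l hl]
    exact inf_le_left

theorem IsSplittingTree.idealIso {f g : List Bool → R} (hf : IsSplittingTree f)
    (hg : IsSplittingTree g) (hfg : ∀ l, f l = ⊥ ↔ g l = ⊥)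
    (hfs : ∀ C, ∃ n, ∀ l, l.length = n → f (true :: l) ≤ C ∧ Disjoint (f (false :: l)) C)
    (hgs : ∀ D, ∃ n, ∀ l, l.length = n → g (true :: l) ≤ D ∧ Disjoint (g (false :: l)) D) :
    IdealIso (f []) (g []) := by
  refine IdealIso.of_rel (fun C D => C ≤ f [] ∧ D ≤ g [] ∧ ∃ n, MatchedAt f g n C D) ?_ ?_ ?_
  · intro C hC
    obtain ⟨n, hn⟩ := hfs C
    obtain ⟨D, hD, h⟩ := hg.exists_matchedAt hn
    exact ⟨D, hD, hC, hD, _, h⟩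
  · intro D hD
    obtain ⟨n, hn⟩ := hgs D
    obtain ⟨C, hC, h⟩ := hf.exists_matchedAt hn
    exact ⟨C, hC, hC, hD, _, h.symm⟩
  · rintro C D C' D' ⟨hC, hD, n, h⟩ ⟨hC', hD', m, h'⟩
    have h := h.mono hf hg (le_max_left n m)
    have h' := h'.mono hf hg (le_max_right n m)
    exact ⟨h.le_of_le hg (fun l => (hfg l).1) h' hD,
      h.symm.le_of_le hf (fun l => (hfg l).2) h'.symm hC⟩

/-- Vaught's back-and-forth theorem for countable Boolean rings. -/
theorem idealIso_of_backAndForth [Countable R] (r : R → R → Prop)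
    (symm : ∀ {x y}, r x y → r y x) (eq_bot : ∀ {x y}, r x y → x = ⊥ → y = ⊥)
    (forth : ∀ {x y c}, r x y → c ≤ x → ∃ d ≤ y, r c d ∧ r (x \ c) (y \ d))
    {A B : R} (h : r A B) : IdealIso A B := by
  have step : ∀ (s : R ⊕ R) (p : {p : R × R // r p.1 p.2}), ∃ q : Bool → {p : R × R // r p.1 p.2},
      ((q true).1.1 ⊔ (q false).1.1 = p.1.1 ∧ Disjoint (q true).1.1 (q false).1.1) ∧
      ((q true).1.2 ⊔ (q false).1.2 = p.1.2 ∧ Disjoint (q true).1.2 (q false).1.2) ∧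
      (∀ c, s = Sum.inl c → (q true).1.1 ≤ c ∧ Disjoint (q false).1.1 c) ∧
      (∀ c, s = Sum.inr c → (q true).1.2 ≤ c ∧ Disjoint (q false).1.2 c) := by
    rintro (c | c) ⟨⟨x, y⟩, hxy⟩
    · obtain ⟨d, hd, h₁, h₂⟩ := forth hxy (inf_le_left (b := c))
      refine ⟨fun b => cond b ⟨(x ⊓ c, d), h₁⟩ ⟨(x \ (x ⊓ c), y \ d), h₂⟩,
        ⟨sup_sdiff_cancel_right inf_le_left, disjoint_sdiff_self_right⟩,
        ⟨sup_sdiff_cancel_right hd, disjoint_sdiff_self_right⟩, ?_, by simp⟩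
      rintro c ⟨⟩
      refine ⟨inf_le_right, ?_⟩
      change Disjoint (x \ (x ⊓ c)) c
      rw [sdiff_inf_self_left]
      exact disjoint_sdiff_self_left
    · obtain ⟨d, hd, h₁, h₂⟩ := forth (symm hxy) (inf_le_left (b := c))
      refine ⟨fun b => cond b ⟨(d, y ⊓ c), symm h₁⟩ ⟨(x \ d, y \ (y ⊓ c)), symm h₂⟩,
        ⟨sup_sdiff_cancel_right hd, disjoint_sdiff_self_right⟩,
        ⟨sup_sdiff_cancel_right inf_le_left, disjoint_sdiff_self_right⟩, by simp, ?_⟩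
      rintro c ⟨⟩
      refine ⟨inf_le_right, ?_⟩
      change Disjoint (y \ (y ⊓ c)) c
      rw [sdiff_inf_self_left]
      exact disjoint_sdiff_self_left
  choose q hq₁ hq₂ hql hqr using step
  obtain ⟨e, he⟩ := exists_surjective_nat (R ⊕ R)
  let T : List Bool → {p : R × R // r p.1 p.2} :=
    List.rec ⟨(A, B), h⟩ fun b l p => q (e l.length) p b
  refine IsSplittingTree.idealIso (f := fun l => (T l).1.1) (g := fun l => (T l).1.2)
    ⟨fun l => (hq₁ _ _).1, fun l => (hq₁ _ _).2⟩ ⟨fun l => (hq₂ _ _).1, fun l => (hq₂ _ _).2⟩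
    (fun l => ⟨eq_bot (T l).2, eq_bot (symm (T l).2)⟩) (fun C => ?_) (fun D => ?_)
  · obtain ⟨n, hn⟩ := he (Sum.inl C)
    exact ⟨n, fun l hl => hql (e l.length) (T l) C (by rw [hl, hn])⟩
  · obtain ⟨n, hn⟩ := he (Sum.inr D)
    exact ⟨n, fun l hl => hqr (e l.length) (T l) D (by rw [hl, hn])⟩

end BackAndForth

section Primitive

variable {R : Type u} [GeneralizedBooleanAlgebra R]

/-- `X` is a disjoint union of finitely many elements that satisfy `p`. -/
inductive IsDisjointSum (p : R → Prop) : R → Prop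
  | bot : IsDisjointSum p ⊥
  | sup {F X : R} : p F → Disjoint F X → IsDisjointSum p X → IsDisjointSum p (F ⊔ X)

theorem IsDisjointSum.mono {p p' : R → Prop} {X : R} (h : IsDisjointSum p X)
    (hp : ∀ F ≤ X, p F → p' F) : IsDisjointSum p' X := by
  induction h with
  | bot => exact .bot
  | sup hF hd _ ih =>
    exact .sup (hp _ le_sup_left hF) hd (ih fun G hG => hp G (hG.trans le_sup_right))

theorem IsPrimitiveRing.isDisjointSum (hR : IsPrimitiveRing R) (A : R) : IsDisjointSum IsPI A := by
  obtain ⟨n, F, hF, hd, rfl⟩ := hR A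
  clear hR
  suffices ∀ s : Finset (Fin n), IsDisjointSum IsPI (s.sup F) from this _
  intro s
  induction s using Finset.induction_on with
  | empty => exact .bot
  | insert i s hi ih =>
    rw [Finset.sup_insert]
    exact .sup (hF i) (Finset.disjoint_sup_right.2 fun j hj => hd (ne_of_mem_of_not_mem hj hi).symm)
      ih

/-- `X` and `Y` are disjoint unions of equally many elements that correspond under `τ`. -/
inductive IsMatchedSum (τ : R → R → Prop) : R → R → Prop
  | bot : IsMatchedSum τ ⊥ ⊥
  | sup {F G X Y : R} : τ F G → Disjoint F X → Disjoint G Y → IsMatchedSum τ X Y →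
      IsMatchedSum τ (F ⊔ X) (G ⊔ Y)

theorem IsMatchedSum.of_rel {τ : R → R → Prop} {F G : R} (h : τ F G) : IsMatchedSum τ F G := by
  simpa using IsMatchedSum.sup h disjoint_bot_right disjoint_bot_right .bot

theorem IsMatchedSum.symm {τ : R → R → Prop} (hτ : ∀ {F G}, τ F G → τ G F) {X Y : R}
    (h : IsMatchedSum τ X Y) : IsMatchedSum τ Y X := by
  induction h with
  | bot => exact .bot
  | sup h hX hY _ ih => exact .sup (hτ h) hY hX ih

theorem IsMatchedSum.sup_sup {τ : R → R → Prop} {X Y X' Y' : R} (h : IsMatchedSum τ X Y)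
    (h' : IsMatchedSum τ X' Y') (hX : Disjoint X X') (hY : Disjoint Y Y') :
    IsMatchedSum τ (X ⊔ X') (Y ⊔ Y') := by
  induction h with
  | bot => simpa using h'
  | sup h hFX hGY _ ih =>
    rw [disjoint_sup_left] at hX hY
    rw [sup_assoc, sup_assoc]
    exact .sup h (disjoint_sup_right.2 ⟨hFX, hX.1⟩) (disjoint_sup_right.2 ⟨hGY, hY.1⟩)
      (ih hX.2 hY.2)

theorem IsMatchedSum.eq_bot {τ : R → R → Prop} (hτ : ∀ {F G}, τ F G → F ≠ ⊥) {X Y : R}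
    (h : IsMatchedSum τ X Y) (hX : X = ⊥) : Y = ⊥ := by
  cases h with
  | bot => rfl
  | sup h => exact absurd (sup_eq_bot_iff.1 hX).1 (hτ h)

theorem IsMatchedSum.idealIso {X Y : R} (h : IsMatchedSum IdealIso X Y) : IdealIso X Y := by
  induction h with
  | bot => exact .refl _
  | sup h hX hY _ ih => exact h.sup ih hX hY

theorem IsMatchedSum.exists_split {τ : R → R → Prop}
    (hτ : ∀ {F G C}, τ F G → C ≤ F →
      ∃ D ≤ G, IsMatchedSum τ C D ∧ IsMatchedSum τ (F \ C) (G \ D))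
    {X Y C : R} (h : IsMatchedSum τ X Y) (hC : C ≤ X) :
    ∃ D ≤ Y, IsMatchedSum τ C D ∧ IsMatchedSum τ (X \ C) (Y \ D) := by
  induction h generalizing C with
  | bot =>
    rw [le_bot_iff.1 hC]
    exact ⟨⊥, le_rfl, .bot, by simpa using IsMatchedSum.bot⟩
  | @sup F G X Y h hX hY _ ih =>
    obtain ⟨D₁, hD₁, h₁, h₁'⟩ := hτ h (inf_le_right (a := C))
    obtain ⟨D₂, hD₂, h₂, h₂'⟩ := ih (inf_le_right (a := C))
    have split : ∀ {P Q S T : R}, Disjoint P Q → S ≤ P → T ≤ Q →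
        (P ⊔ Q) \ (S ⊔ T) = P \ S ⊔ Q \ T := fun {P Q S T} hPQ hS hT => by
      rw [sup_sdiff, ← sdiff_sdiff_left, sup_comm S T, ← sdiff_sdiff_left,
        (hPQ.mono sdiff_le hT).sdiff_eq_left,
        (hPQ.symm.mono sdiff_le hS).sdiff_eq_left]
    have hC' : C ⊓ F ⊔ C ⊓ X = C := by
      rw [← inf_sup_left]
      exact inf_eq_left.2 hC
    refine ⟨D₁ ⊔ D₂, sup_le_sup hD₁ hD₂, ?_, ?_⟩
    · have := h₁.sup_sup h₂ (hX.mono inf_le_right inf_le_right) (hY.mono hD₁ hD₂)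
      rwa [hC'] at this
    · have := h₁'.sup_sup h₂' (hX.mono sdiff_le sdiff_le) (hY.mono sdiff_le sdiff_le)
      rwa [← split hX inf_le_right inf_le_right, ← split hY hD₁ hD₂, hC'] at this

/-- If `B` absorbs a partner of each summand of `X`, then a partner of `X` can be removed from `B`
without changing `(B)`. -/
theorem IsDisjointSum.exists_isMatchedSum {τ : R → R → Prop}
    (hτ : ∀ {F G G'}, τ F G → IdealIso G G' → τ F G') {B X : R}
    (h : IsDisjointSum (fun F => ∃ G, τ F G ∧ IdealAbsorbs B G) X) :
    ∃ E ≤ B, IdealIso B (B \ E) ∧ IsMatchedSum τ X E := by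
  induction h with
  | bot => exact ⟨⊥, bot_le, by simpa using IdealIso.refl B, .bot⟩
  | @sup F X hF hd _ ih =>
    obtain ⟨E, hE, hBE, hX⟩ := ih
    obtain ⟨G, hFG, hG⟩ := hF
    obtain ⟨G', hG', hGG', hBG'⟩ := (hG.congr hBE (.refl G)).exists_le
    refine ⟨G' ⊔ E, sup_le (hG'.trans sdiff_le) hE, ?_,
      .sup (hτ hFG hGG') hd (disjoint_sdiff_self_left.mono_left hG') hX⟩
    rw [sup_comm, ← sdiff_sdiff_left]
    exact hBE.trans hBG'

theorem IsPI.congr {A B : R} (hA : IsPI A) (h : IdealIso A B) : IsPI B := by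
  refine ⟨fun hB => hA.1 (h.symm.eq_bot hB), fun D hD => ?_⟩
  obtain ⟨C, hC, h₁, h₂⟩ := h.symm.exists_split hD
  exact (hA.2 C hC).imp (fun h' => h₁.trans (h'.trans h)) fun h' => h₂.trans (h'.trans h)

theorem IsPI.idealIso_or_idealAbsorbs {A F : R} (hA : IsPI A) (hF : F ≤ A) :
    IdealIso F A ∨ IdealAbsorbs A F :=
  (hA.2 F hF).imp_right (idealAbsorbs_of_le hF)

/-- A PI element that contains two disjoint copies of itself absorbs itself. -/
theorem IsPI.idealAbsorbs_self [Countable R] (hR : IsPrimitiveRing R) {A F G : R} (hA : IsPI A)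
    (hF : F ≤ A) (hG : G ≤ A) (hd : Disjoint F G) (hFA : IdealIso F A) (hGA : IdealIso G A) :
    IdealAbsorbs A A := by
  let copy : R → Prop := fun X => ∃ Z ≤ X, IdealIso A Z
  have copy_mono : ∀ {X Y}, X ≤ Y → copy X → copy Y := fun h ⟨Z, hZ, e⟩ => ⟨Z, hZ.trans h, e⟩
  -- An element below `A` without a copy of `A` can be removed from any element with such a copy.
  have remove : ∀ {X Y}, X ≤ A → ¬ copy X → copy Y → ∃ E ≤ Y, IdealIso X E ∧ copy (Y \ E) := by
    rintro X Y hXA hX ⟨Z, hZ, e⟩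
    have hX' : IsDisjointSum (fun F => ∃ G, IdealIso F G ∧ IdealAbsorbs Z G) X :=
      (hR.isDisjointSum X).mono fun F hF _ => ⟨F, .refl F,
        ((hA.idealIso_or_idealAbsorbs (hF.trans hXA)).resolve_left
          fun h => hX ⟨F, hF, h.symm⟩).congr e (.refl F)⟩
    obtain ⟨E, hE, hZE, hXE⟩ := IsDisjointSum.exists_isMatchedSum (τ := IdealIso) IdealIso.trans hX'
    exact ⟨E, hE.trans hZ, hXE.idealIso, Z \ E, sdiff_le_sdiff_right hZ, e.trans hZE⟩
  have key : IdealIso A (F ⊔ G) := by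
    refine idealIso_of_backAndForth
      (fun X Y => X ≤ A ∧ Y ≤ A ∧ (IdealIso X Y ∨ copy X ∧ copy Y)) ?_ ?_ ?_
      ⟨le_rfl, sup_le hF hG, .inr ⟨⟨A, le_rfl, .refl A⟩, F, le_sup_left, hFA.symm⟩⟩
    · exact fun ⟨hX, hY, h⟩ => ⟨hY, hX, h.imp IdealIso.symm And.symm⟩
    · rintro X Y ⟨_, _, h | ⟨⟨Z, hZ, e⟩, _⟩⟩ rfl
      · exact h.eq_bot rfl
      · exact absurd (e.symm.eq_bot (le_bot_iff.1 hZ)) hA.1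
    · rintro X Y C ⟨hX, hY, h⟩ hC
      suffices ∃ D ≤ Y, (IdealIso C D ∨ copy C ∧ copy D) ∧
          (IdealIso (X \ C) (Y \ D) ∨ copy (X \ C) ∧ copy (Y \ D)) by
        obtain ⟨D, hD, h₁, h₂⟩ := this
        exact ⟨D, hD, ⟨hC.trans hX, hD.trans hY, h₁⟩, sdiff_le.trans hX, sdiff_le.trans hY, h₂⟩
      rcases h with h | ⟨⟨Z, hZ, e⟩, hcY⟩
      · obtain ⟨D, hD, h₁, h₂⟩ := h.exists_split hC
        exact ⟨D, hD, .inl h₁, .inl h₂⟩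
      by_cases h₁ : copy C
      · by_cases h₂ : copy (X \ C)
        · obtain ⟨Z', hZ', e'⟩ := hcY
          obtain ⟨D, hD, hFD, hD'⟩ := e'.exists_split hF
          refine ⟨D, hD.trans hZ', .inr ⟨h₁, D, le_rfl, hFA.symm.trans hFD⟩, .inr ⟨h₂, ?_⟩⟩
          obtain ⟨D', hD'', h', _⟩ := hD'.exists_split
            (show G ≤ A \ F from le_sdiff.2 ⟨hG, hd.symm⟩)
          exact ⟨D', hD''.trans (sdiff_le_sdiff_right hZ'), hGA.symm.trans h'⟩
        · obtain ⟨E, hE, hXE, hYE⟩ := remove (sdiff_le.trans hX) h₂ hcY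
          refine ⟨Y \ E, sdiff_le, .inr ⟨h₁, hYE⟩, .inl ?_⟩
          rwa [sdiff_sdiff_eq_self hE]
      · obtain ⟨E, hE, hCE, hYE⟩ := remove (hC.trans hX) h₁ hcY
        refine ⟨E, hE, .inl hCE, .inr ⟨?_, hYE⟩⟩
        rcases (hA.congr e).2 (Z ⊓ C) inf_le_left with h | h
        · exact absurd ⟨Z ⊓ C, inf_le_right, e.trans h.symm⟩ h₁
        · refine ⟨_, ?_, e.trans h.symm⟩
          rw [sdiff_inf_self_left]
          exact sdiff_le_sdiff_right hZ
  obtain ⟨e⟩ := key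
  obtain ⟨f⟩ := hFA
  obtain ⟨g⟩ := hGA
  exact ⟨((e.trans (iicSupOrderIso hd)).trans (orderIsoProd f g)).symm⟩

/-- When a PI element splits off a copy of itself, it absorbs every part of the remainder. -/
theorem IsPI.idealAbsorbs_of_disjoint [Countable R] (hR : IsPrimitiveRing R) {A C F : R}
    (hA : IsPI A) (hC : C ≤ A) (hCA : IdealIso C A) (hF : F ≤ A \ C) : IdealAbsorbs A F := by
  obtain ⟨hFA, hFC⟩ := le_sdiff.1 hF
  refine (hA.idealIso_or_idealAbsorbs hFA).elim (fun h => ?_) id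
  exact (hA.idealAbsorbs_self hR hC hFA hFC.symm hCA h).congr (.refl A) h.symm

/-- The PO system of a countable primitive Boolean ring is simple. -/
theorem piSystem_isSimple [Countable R] (hR : IsPrimitiveRing R) :
    POSystem.IsSimple.{u, v} (piSystem R) := by
  intro P SP α hα
  let cl : ∀ A : R, IsPI A → PIClass R := fun A hA => Quotient.mk (piIsoSetoid R) ⟨A, hA⟩
  let τ : R → R → Prop := fun F G => ∃ (hF : IsPI F) (hG : IsPI G), α (cl F hF) = α (cl G hG)
  have cl_eq : ∀ {A B} (hA : IsPI A) (hB : IsPI B), IdealIso A B → cl A hA = cl B hB :=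
    fun _ _ h => Quotient.sound h
  have τ_symm : ∀ {F G}, τ F G → τ G F := fun ⟨hF, hG, h⟩ => ⟨hG, hF, h.symm⟩
  have τ_congr : ∀ {F G G'}, τ F G → IdealIso G G' → τ F G' := fun ⟨hF, hG, h⟩ e =>
    ⟨hF, hG.congr e, h.trans (congrArg α (cl_eq hG (hG.congr e) e))⟩
  have lift : ∀ {A B F}, τ A B → IsPI F → IdealAbsorbs A F →
      ∃ G, τ F G ∧ IdealAbsorbs B G := by
    rintro A B F ⟨hA, hB, h⟩ hF hAF
    have h₁ : α (cl F hF) ∈ α '' {r | (piSystem R).lt (cl A hA) r} := ⟨_, hAF, rfl⟩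
    rw [hα, h, ← hα] at h₁
    obtain ⟨s, hs, hsF⟩ := h₁
    induction s using Quotient.inductionOn with
    | h G => exact ⟨G.1, ⟨hF, G.2, hsF.symm⟩, hs⟩
  have absorb : ∀ {A B C}, τ A B → C ≤ A → IdealIso C A →
      ∃ E ≤ B, IsMatchedSum τ C (B \ E) ∧ IsMatchedSum τ (A \ C) E := by
    intro A B C h hC hCA
    have hA : IsPI A := h.1
    have hX : IsDisjointSum (fun F => ∃ G, τ F G ∧ IdealAbsorbs B G) (A \ C) :=
      (hR.isDisjointSum _).mono fun F hF hFPI =>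
        lift h hFPI (hA.idealAbsorbs_of_disjoint hR hC hCA hF)
    obtain ⟨E, hE, hBE, hXE⟩ := IsDisjointSum.exists_isMatchedSum (τ := τ) τ_congr hX
    exact ⟨E, hE, .of_rel (τ_congr (τ_symm (τ_congr (τ_symm h) hCA.symm)) hBE), hXE⟩
  have main : ∀ {A B}, τ A B → IdealIso A B := fun h => by
    refine idealIso_of_backAndForth (IsMatchedSum τ) (IsMatchedSum.symm τ_symm)
      (IsMatchedSum.eq_bot fun h => h.1.1) (IsMatchedSum.exists_split ?_) (.of_rel h)
    intro A B C h hC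
    rcases h.1.2 C hC with hCA | hCA
    · obtain ⟨E, hE, h₁, h₂⟩ := absorb h hC hCA
      exact ⟨B \ E, sdiff_le, h₁, by rwa [sdiff_sdiff_eq_self hE]⟩
    · obtain ⟨E, hE, h₁, h₂⟩ := absorb h sdiff_le hCA
      rw [sdiff_sdiff_eq_self hC] at h₂
      exact ⟨E, hE, h₂, h₁⟩
  intro a b
  induction a, b using Quotient.inductionOn₂ with
  | h A B => exact fun h => Quotient.sound (main ⟨A.2, B.2, h⟩)

end Primitive

/-- A second countable space has only countably many compact open subsets. -/
theorem TopologicalSpace.CompactOpens.countable (W : Type u) [TopologicalSpace W]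
    [SecondCountableTopology W] : Countable (CompactOpens W) := by
  have key : ∀ U : CompactOpens W, ∃ s : Finset (countableBasis W),
      (U : Set W) = ⋃₀ ((fun x : countableBasis W => x.1) '' (s : Set (countableBasis W))) := by
    intro U
    obtain ⟨s, hs, hU⟩ := eq_finite_iUnion_of_isTopologicalBasis_of_isCompact_open
      (fun x : countableBasis W => x.1) (by simpa using isBasis_countableBasis W) (U : Set W)
      U.isCompact U.isOpen
    refine ⟨hs.toFinset, ?_⟩
    rw [hU]
    simp
  choose s hs using key
  refine Function.Injective.countable (f := s) fun U V h => SetLike.coe_injective ?_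
  rw [hs U, hs V, h]

/-- The structure diagram of a primitive ω-Stone space is a simple PO system. -/
theorem structure_diagram_simple (W : Type u) [TopologicalSpace W] [OmegaStoneSpace W]
    (hW : IsPrimitiveSpace W) : POSystem.IsSimple.{u, v} (structureDiagram W) := by
  have := CompactOpens.countable W
  exact piSystem_isSimple hW
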